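/- arXiv:2005.01774 — 2 statements merged into one kernel-verified Lean document; each statement's English description precedes it below -/
import Mathlib

section
/- Let (X₀,δ) be an infinite countable uniformly discrete metric space with bounded geometry satisfying Yu's Property A. Let H be a self-adjoint band-dominated operator on ℓ²(X₀), with matrix H(x,y) := ⟨H δ_y, δ_x⟩. For every subset M₀ ⊆ X₀ with finite complement, let H_{M₀} be the bounded operator on ℓ²(M₀) given by [H_{M₀}(v)](a) = Σ_{b∈M₀} H(a,b) v(b) (the compression of H to ℓ²(M₀)). Then inf sp_ess(H) = sup over all cofinite M₀ ⊆ X₀ of inf sp(H_{M₀}), and sup sp_ess(H) = inf over all cofinite M₀ ⊆ X₀ of sup sp(H_{M₀}). -/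
open scoped ENNReal

noncomputable section

/-- The Hilbert space `ℓ²(X)` of square-summable complex functions on `X`. -/
abbrev l2 (X : Type) : Type := lp (fun _ : X => ℂ) 2

/-- The matrix entry `H(x,y) = ⟨H δ_y, δ_x⟩` of a bounded operator on `ℓ²(X)`,
i.e. the `x`-th coordinate of `H δ_y`. -/
def matrixEntry {X : Type} [DecidableEq X] (H : l2 X →L[ℂ] l2 X) (x y : X) : ℂ :=
  (H (lp.single 2 y 1)) x

/-- A band operator: bounded matrix entries, vanishing at distance `> r` from the diagonal. -/
def IsBand {X : Type} [MetricSpace X] [DecidableEq X] (H : l2 X →L[ℂ] l2 X) : Prop :=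
  (∃ C : ℝ, ∀ x y : X, ‖matrixEntry H x y‖ ≤ C) ∧
    ∃ r > (0 : ℝ), ∀ x y : X, dist x y > r → matrixEntry H x y = 0

/-- A band-dominated operator: an operator-norm limit of band operators. -/
def IsBandDominated {X : Type} [MetricSpace X] [DecidableEq X]
    (H : l2 X →L[ℂ] l2 X) : Prop :=
  H ∈ closure {T : l2 X →L[ℂ] l2 X | IsBand T}

/-- The (real) essential spectrum of a bounded operator: the spectrum of its image in the
Calkin algebra, i.e. `t` belongs to it iff `H - t` is not invertible modulo the closed ideal
of compact operators. -/
def essSpectrum {X : Type} (H : l2 X →L[ℂ] l2 X) : Set ℝ :=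
  {t : ℝ | ¬ ∃ S : l2 X →L[ℂ] l2 X,
      IsCompactOperator ⇑(S * (H - (t : ℂ) • 1) - 1) ∧
      IsCompactOperator ⇑((H - (t : ℂ) • 1) * S - 1)}

open scoped InnerProductSpace

section Hilbert

variable {E : Type*} [NormedAddCommGroup E] [InnerProductSpace ℂ E]

theorem sub_algebraMap_apply (A : E →L[ℂ] E) (c : ℝ) (v : E) :
    (A - algebraMap ℝ (E →L[ℂ] E) c) v = A v - (c : ℂ) • v := by
  rw [sub_apply, Algebra.algebraMap_eq_smul_one, smul_apply, one_apply_eq_self, Complex.coe_smul]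

theorem norm_sub_algebraMap_le (A : E →L[ℂ] E) (c : ℝ) :
    ‖A - algebraMap ℝ (E →L[ℂ] E) c‖ ≤ ‖A‖ + |c| := by
  refine ContinuousLinearMap.opNorm_le_bound _ (by positivity) fun v => ?_
  rw [sub_algebraMap_apply, add_mul]
  refine (norm_sub_le _ _).trans (add_le_add (A.le_opNorm v) ?_)
  rw [norm_smul, Complex.norm_real, Real.norm_eq_abs]

theorem exists_inverse_mod_compact {F : Type*} [NormedAddCommGroup F] [InnerProductSpace ℂ F]
    {B : E →L[ℂ] E} {R : E →L[ℂ] F} {J : F →L[ℂ] E} {T : F →L[ℂ] F}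
    (hl : ∀ w, T (R (B (J w))) = w) (hr : ∀ w, R (B (J (T w))) = w)
    (hP : IsCompactOperator ⇑(1 - J ∘L R)) :
    ∃ S : E →L[ℂ] E, IsCompactOperator ⇑(S * B - 1) ∧ IsCompactOperator ⇑(B * S - 1) := by
  refine ⟨J ∘L T ∘L R, ?_, ?_⟩
  · have h : (J ∘L T ∘L R) * B - 1 =
        (J ∘L T ∘L R ∘L B) ∘L (1 - J ∘L R) - (1 - J ∘L R) := by
      ext1 v
      simp [hl]
    rw [h]
    exact (hP.clm_comp (J ∘L T ∘L R ∘L B)).sub hP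
  · have h : B * (J ∘L T ∘L R) - 1 =
        (1 - J ∘L R) ∘L (B ∘L J ∘L T ∘L R) - (1 - J ∘L R) := by
      ext1 v
      simp [hr]
    rw [h]
    exact (hP.comp_clm (B ∘L J ∘L T ∘L R)).sub hP

variable [CompleteSpace E]

theorem sub_algebraMap_isPositive {A : E →L[ℂ] E} (hA : IsSelfAdjoint A) {c : ℝ}
    (h : ∀ x ∈ spectrum ℝ A, c ≤ x) : (A - algebraMap ℝ (E →L[ℂ] E) c).IsPositive :=
  (ContinuousLinearMap.le_def _ _).1 ((algebraMap_le_iff_le_spectrum hA).2 h)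

theorem le_spectrum_of_le_inner {A : E →L[ℂ] E} (hA : IsSelfAdjoint A) {c : ℝ}
    (h : ∀ v : E, ‖v‖ = 1 → c ≤ (⟪A v, v⟫_ℂ).re) : ∀ x ∈ spectrum ℝ A, c ≤ x := by
  rw [← algebraMap_le_iff_le_spectrum hA, ContinuousLinearMap.le_def,
    ContinuousLinearMap.isPositive_def']
  refine ⟨hA.sub (IsSelfAdjoint.algebraMap _ (IsSelfAdjoint.all c)), fun v => ?_⟩
  rcases eq_or_ne v 0 with rfl | hv
  · simp [ContinuousLinearMap.reApplyInnerSelf_apply]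
  have hv' : 0 < ‖v‖ := norm_pos_iff.2 hv
  have h1 := h (((‖v‖⁻¹ : ℝ) : ℂ) • v) (by
    rw [norm_smul, Complex.norm_real, norm_inv, norm_norm, inv_mul_cancel₀ hv'.ne'])
  rw [map_smul, inner_smul_left, inner_smul_right, Complex.conj_ofReal, Complex.re_ofReal_mul,
    Complex.re_ofReal_mul] at h1
  have h2 : (A - algebraMap ℝ (E →L[ℂ] E) c).reApplyInnerSelf v =
      (⟪A v, v⟫_ℂ).re - c * ‖v‖ ^ 2 := by
    rw [ContinuousLinearMap.reApplyInnerSelf_apply, sub_algebraMap_apply, inner_sub_left,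
      inner_smul_left, inner_self_eq_norm_sq_to_K, Complex.conj_ofReal, map_sub]
    congr 1
    exact (Complex.re_ofReal_mul _ _).trans (by norm_cast)
  rw [h2]
  have h3 := mul_le_mul_of_nonneg_right h1 (sq_nonneg ‖v‖)
  have h4 : ‖v‖⁻¹ * (‖v‖⁻¹ * (⟪A v, v⟫_ℂ).re) * ‖v‖ ^ 2 = (⟪A v, v⟫_ℂ).re := by
    field_simp
  linarith

theorem exists_re_inner_lt [Nontrivial E] {A : E →L[ℂ] E} (hA : IsSelfAdjoint A) {c : ℝ}
    (hc : sInf (spectrum ℝ A) < c) : ∃ v : E, ‖v‖ = 1 ∧ (⟪A v, v⟫_ℂ).re < c := by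
  by_contra! h
  exact hc.not_ge (le_csInf (ContinuousFunctionalCalculus.spectrum_nonempty A hA)
    (le_spectrum_of_le_inner hA h))

theorem bddBelow_spectrum (A : E →L[ℂ] E) : BddBelow (spectrum ℝ A) :=
  (spectrum.isBounded A).bddBelow

theorem sInf_spectrum_le_norm [Nontrivial E] {A : E →L[ℂ] E} (hA : IsSelfAdjoint A) :
    sInf (spectrum ℝ A) ≤ ‖A‖ := by
  obtain ⟨x, hx⟩ := ContinuousFunctionalCalculus.spectrum_nonempty (R := ℝ) A hA
  exact (csInf_le (bddBelow_spectrum A) hx).trans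
    ((le_abs_self x).trans (spectrum.norm_le_norm_of_mem hx))

theorem ContinuousLinearMap.IsPositive.norm_apply_sq_le {B : E →L[ℂ] E} (hB : B.IsPositive)
    (v : E) : ‖B v‖ ^ 2 ≤ ‖B‖ * (⟪B v, v⟫_ℂ).re := by
  obtain ⟨C, rfl⟩ := CStarAlgebra.nonneg_iff_eq_star_mul_self.1
    ((ContinuousLinearMap.nonneg_iff_isPositive B).2 hB)
  have h1 : (⟪(star C * C) v, v⟫_ℂ).re = ‖C v‖ ^ 2 := by
    rw [mul_apply_eq_comp, ContinuousLinearMap.star_eq_adjoint,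
      ContinuousLinearMap.adjoint_inner_left, inner_self_eq_norm_sq_to_K]
    norm_cast
  rw [h1, CStarRing.norm_star_mul_self, mul_apply_eq_comp]
  have h2 : ‖star C (C v)‖ ≤ ‖C‖ * ‖C v‖ := by
    simpa using (star C).le_opNorm (C v)
  calc _ ≤ (‖C‖ * ‖C v‖) ^ 2 := by gcongr
    _ = _ := by ring

theorem norm_sub_smul_sq_le {A : E →L[ℂ] E} (hA : IsSelfAdjoint A) {c : ℝ}
    (h : ∀ x ∈ spectrum ℝ A, c ≤ x) {v : E} (hv : ‖v‖ = 1) :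
    ‖A v - (c : ℂ) • v‖ ^ 2 ≤ (‖A‖ + |c|) * ((⟪A v, v⟫_ℂ).re - c) := by
  have hB := sub_algebraMap_isPositive hA h
  have h1 := hB.norm_apply_sq_le v
  have h2 := hB.re_inner_nonneg_left v
  have h3 : (⟪(A - algebraMap ℝ (E →L[ℂ] E) c) v, v⟫_ℂ).re = (⟪A v, v⟫_ℂ).re - c := by
    rw [sub_algebraMap_apply, inner_sub_left, inner_smul_left, inner_self_eq_norm_sq_to_K, hv]
    simp
  change 0 ≤ (⟪(A - algebraMap ℝ (E →L[ℂ] E) c) v, v⟫_ℂ).re at h2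
  rw [h3] at h1 h2
  rw [← sub_algebraMap_apply]
  exact h1.trans (mul_le_mul_of_nonneg_right (norm_sub_algebraMap_le A c) h2)

end Hilbert

section Restrict

variable {X : Type}

/-- Restriction of square-summable functions to a subset. -/
def restrictL2 (M : Set X) : l2 X →L[ℂ] l2 M :=
  LinearMap.mkContinuous
    { toFun := fun v => ⟨fun a => v a, by
        have hv := (memℓp_gen_iff (by norm_num)).1 (lp.memℓp v)
        exact (memℓp_gen_iff (by norm_num)).2 (hv.comp_injective Subtype.val_injective)⟩
      map_add' := fun _ _ => rfl
      map_smul' := fun _ _ => rfl } 1 (fun v => by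
        rw [one_mul]
        refine lp.norm_le_of_forall_sum_le (by norm_num) (norm_nonneg _) fun s => ?_
        have := lp.sum_rpow_le_norm_rpow (p := 2) (by norm_num) v
          (s.map (Function.Embedding.subtype _))
        rw [Finset.sum_map] at this
        exact this)

@[simp]
theorem restrictL2_apply (M : Set X) (v : l2 X) (a : M) : restrictL2 M v a = v a := rfl

theorem norm_restrictL2_le (M : Set X) : ‖restrictL2 M‖ ≤ 1 :=
  LinearMap.mkContinuous_norm_le _ zero_le_one _

/-- Extension by zero of square-summable functions on a subset. -/
def extendL2 (M : Set X) : l2 M →L[ℂ] l2 X := ContinuousLinearMap.adjoint (restrictL2 M)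

theorem norm_extendL2_le (M : Set X) : ‖extendL2 M‖ ≤ 1 := by
  rw [extendL2, LinearIsometryEquiv.norm_map]
  exact norm_restrictL2_le M

theorem inner_extendL2_right (M : Set X) (v : l2 M) (w : l2 X) :
    ⟪w, extendL2 M v⟫_ℂ = ⟪restrictL2 M w, v⟫_ℂ :=
  ContinuousLinearMap.adjoint_inner_right _ _ _

/-- The compression of an operator to the square-summable functions on a subset. -/
def compressL2 (H : l2 X →L[ℂ] l2 X) (M : Set X) : l2 M →L[ℂ] l2 M :=
  restrictL2 M ∘L H ∘L extendL2 M

theorem isSelfAdjoint_compressL2 {H : l2 X →L[ℂ] l2 X} (hH : IsSelfAdjoint H) (M : Set X) :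
    IsSelfAdjoint (compressL2 H M) := by
  have := hH.adjoint_conj (extendL2 M)
  simpa [compressL2, extendL2] using this

theorem norm_compressL2_le (H : l2 X →L[ℂ] l2 X) (M : Set X) : ‖compressL2 H M‖ ≤ ‖H‖ := by
  calc _ ≤ ‖restrictL2 M‖ * (‖H‖ * ‖extendL2 M‖) :=
        (ContinuousLinearMap.opNorm_comp_le _ _).trans (by
          gcongr; exact ContinuousLinearMap.opNorm_comp_le _ _)
    _ ≤ 1 * (‖H‖ * 1) := by
        gcongr
        exacts [norm_restrictL2_le M, norm_extendL2_le M]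
    _ = ‖H‖ := by ring

variable [DecidableEq X]

theorem extendL2_apply_mem (M : Set X) (v : l2 M) (a : M) : extendL2 M v a = v a := by
  have h1 : ⟪lp.single 2 (a : X) (1 : ℂ), extendL2 M v⟫_ℂ = extendL2 M v a := by
    simp [lp.inner_single_left]
  have h2 : restrictL2 M (lp.single 2 (a : X) (1 : ℂ)) = lp.single 2 a (1 : ℂ) := by
    ext b
    simp [Pi.single_apply, Subtype.ext_iff]
  rw [← h1, inner_extendL2_right, h2]
  simp [lp.inner_single_left]

theorem extendL2_apply_notMem (M : Set X) (v : l2 M) {x : X} (hx : x ∉ M) :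
    extendL2 M v x = 0 := by
  have h1 : ⟪lp.single 2 x (1 : ℂ), extendL2 M v⟫_ℂ = extendL2 M v x := by
    simp [lp.inner_single_left]
  have h2 : restrictL2 M (lp.single 2 x (1 : ℂ)) = 0 := by
    ext b
    have : (b : X) ≠ x := fun h => hx (h ▸ b.2)
    simp [this]
  rw [← h1, inner_extendL2_right, h2, inner_zero_left]

theorem restrictL2_extendL2 (M : Set X) (v : l2 M) : restrictL2 M (extendL2 M v) = v := by
  ext a
  exact extendL2_apply_mem M v a

theorem extendL2_restrictL2_of_support (M : Set X) {v : l2 X} (hv : ∀ x ∉ M, v x = 0) :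
    extendL2 M (restrictL2 M v) = v := by
  ext x
  by_cases hx : x ∈ M
  · exact extendL2_apply_mem M _ ⟨x, hx⟩
  · rw [extendL2_apply_notMem M _ hx, hv x hx]

theorem norm_extendL2_apply (M : Set X) (v : l2 M) : ‖extendL2 M v‖ = ‖v‖ := by
  apply le_antisymm
  · exact ((extendL2 M).le_of_opNorm_le (norm_extendL2_le M) v).trans_eq (one_mul _)
  · conv_lhs => rw [← restrictL2_extendL2 M v]
    exact ((restrictL2 M).le_of_opNorm_le (norm_restrictL2_le M) _).trans_eq (one_mul _)

theorem extendL2_single (M : Set X) (a : M) (c : ℂ) :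
    extendL2 M (lp.single 2 a c) = lp.single 2 (a : X) c := by
  ext x
  by_cases hx : x ∈ M
  · rw [show x = ((⟨x, hx⟩ : M) : X) from rfl, extendL2_apply_mem]
    simp [Pi.single_apply, Subtype.ext_iff]
  · rw [extendL2_apply_notMem M _ hx]
    have : x ≠ a := fun h => hx (h ▸ a.2)
    simp [this]

theorem isCompactOperator_one_sub_extendL2_restrictL2 {M : Set X} (hM : Mᶜ.Finite) :
    IsCompactOperator ⇑(1 - extendL2 M ∘L restrictL2 M) := by
  have h : 1 - extendL2 M ∘L restrictL2 M =
      ∑ x ∈ hM.toFinset, (ContinuousLinearMap.toSpanSingleton ℂ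
        (lp.single 2 x (1 : ℂ) : l2 X)) ∘L (lp.evalCLM ℂ (fun _ : X => ℂ) 2 x) := by
    ext v y
    rw [sum_apply, lp.coeFn_sum, Finset.sum_apply]
    by_cases hy : y ∈ M
    · have := extendL2_apply_mem M (restrictL2 M v) ⟨y, hy⟩
      rw [Finset.sum_eq_zero]
      · simpa [sub_eq_zero] using this.symm
      · intro x hx
        have : y ≠ x := by rintro rfl; simp at hx; exact hx hy
        simp [this]
    · have := extendL2_apply_notMem M (restrictL2 M v) hy
      rw [Finset.sum_eq_single y]
      · simpa [lp.evalCLM] using this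
      · intro x _ hx
        simp [hx.symm]
      · simp [hy]
  rw [h]
  refine Submodule.sum_mem (compactOperator (RingHom.id ℂ) (l2 X) (l2 X)) (fun x _ => ?_)
  have h2 : IsCompactOperator (ContinuousLinearMap.toSpanSingleton ℂ
      (lp.single 2 x (1 : ℂ) : l2 X)) :=
    isCompactOperator_of_locallyCompactSpace_rng
      (ContinuousLinearMap.toSpanSingleton ℂ (lp.single 2 x (1 : ℂ) : l2 X))
  exact h2.comp_clm (lp.evalCLM ℂ (fun _ : X => ℂ) 2 x)

theorem compressL2_apply_eq_tsum (H : l2 X →L[ℂ] l2 X) (M : Set X) (v : l2 M) (a : M) :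
    compressL2 H M v a = ∑' b : M, matrixEntry H a b * v b := by
  have h1 := lp.hasSum_single (p := 2) (by norm_num) v
  have h2 := h1.mapL ((lp.evalCLM ℂ (fun _ : X => ℂ) 2 (a : X)) ∘L H ∘L extendL2 M)
  refine (h2.tsum_eq.symm.trans (tsum_congr fun b => ?_))
  have h3 : (lp.single 2 (b : X) (v b) : l2 X) = v b • lp.single 2 (b : X) (1 : ℂ) := by
    rw [← lp.single_smul, smul_eq_mul, mul_one]
  change H (extendL2 M (lp.single 2 b (v b))) a = _
  rw [extendL2_single, h3, map_smul, matrixEntry, lp.coeFn_smul, Pi.smul_apply, smul_eq_mul,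
    mul_comm]

end Restrict

section Decay

variable {X : Type} [DecidableEq X]

theorem exists_finset_norm_inner_le (w : l2 X) {ε : ℝ} (hε : 0 < ε) :
    ∃ F : Finset X, ∀ G : Finset X, F ⊆ G → ∀ v : l2 X, ‖v‖ ≤ 1 → (∀ x ∈ G, v x = 0) →
      ‖⟪v, w⟫_ℂ‖ ≤ ε := by
  have h1 := lp.hasSum_single (p := 2) (by norm_num) w
  obtain ⟨F, hF⟩ := Filter.eventually_atTop.1 (h1.eventually (Metric.ball_mem_nhds w hε))
  refine ⟨F, fun G hG v hv hvG => ?_⟩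
  have h2 : ⟪v, ∑ x ∈ G, lp.single 2 x (w x)⟫_ℂ = 0 := by
    rw [inner_sum]
    refine Finset.sum_eq_zero fun x hx => ?_
    rw [lp.inner_single_right, hvG x hx, inner_zero_left]
  have h3 : ⟪v, w⟫_ℂ = ⟪v, w - ∑ x ∈ G, lp.single 2 x (w x)⟫_ℂ := by
    rw [inner_sub_right, h2, sub_zero]
  have h4 : ‖w - ∑ x ∈ G, lp.single 2 x (w x)‖ ≤ ε := by
    rw [norm_sub_rev, ← dist_eq_norm]
    exact (Metric.mem_ball.1 (hF G hG)).le
  rw [h3]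
  calc _ ≤ ‖v‖ * ‖w - ∑ x ∈ G, lp.single 2 x (w x)‖ := norm_inner_le_norm _ _
    _ ≤ 1 * ε := by gcongr
    _ = ε := one_mul _

theorem IsCompactOperator.exists_finset_norm_apply_le {K : l2 X →L[ℂ] l2 X}
    (hK : IsCompactOperator K) {ε : ℝ} (hε : 0 < ε) :
    ∃ F : Finset X, ∀ v : l2 X, ‖v‖ ≤ 1 → (∀ x ∈ F, v x = 0) → ‖K v‖ ≤ ε := by
  obtain ⟨C, hC, hKC⟩ := hK.image_closedBall_subset_compact (f := (K : l2 X →ₗ[ℂ] l2 X)) 1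
  set η : ℝ := ε ^ 2 / (2 * (‖K‖ + 1)) with hη
  have hη0 : 0 < η := by positivity
  obtain ⟨t, ht, hCt⟩ := Metric.totallyBounded_iff.1 hC.totallyBounded η hη0
  choose F hF using fun w : l2 X => exists_finset_norm_inner_le w (half_pos (pow_pos hε 2))
  refine ⟨ht.toFinset.biUnion fun y => F (ContinuousLinearMap.adjoint K y), fun v hv hvF => ?_⟩
  obtain ⟨y, hyt, hy⟩ : ∃ y ∈ t, dist (K v) y < η := by
    have := hCt (hKC ⟨v, by simpa using hv, rfl⟩)
    simpa using this
  have h1 : ‖⟪K v, y⟫_ℂ‖ ≤ ε ^ 2 / 2 := by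
    rw [← ContinuousLinearMap.adjoint_inner_right]
    exact hF _ _ (Finset.subset_biUnion_of_mem
      (fun y => F (ContinuousLinearMap.adjoint K y)) (ht.mem_toFinset.2 hyt)) v hv hvF
  have h2 : ‖⟪K v, K v - y⟫_ℂ‖ ≤ ε ^ 2 / 2 := by
    calc _ ≤ ‖K v‖ * ‖K v - y‖ := norm_inner_le_norm _ _
      _ ≤ (‖K‖ + 1) * η := by
        gcongr
        · exact (K.le_opNorm_of_le hv).trans (by linarith [norm_nonneg K])
        · rw [← dist_eq_norm]; exact hy.le
      _ = ε ^ 2 / 2 := by rw [hη]; field_simp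
  have h3 : ‖K v‖ ^ 2 ≤ ε ^ 2 := by
    calc ‖K v‖ ^ 2 = ‖⟪K v, K v⟫_ℂ‖ := by
          rw [inner_self_eq_norm_sq_to_K, norm_pow]; simp
      _ = ‖⟪K v, K v - y⟫_ℂ + ⟪K v, y⟫_ℂ‖ := by rw [← inner_add_right, sub_add_cancel]
      _ ≤ _ := (norm_add_le _ _).trans (by linarith)
  exact (sq_le_sq₀ (norm_nonneg _) hε.le).1 h3

end Decay

section Persson

variable {X : Type}

theorem essSpectrum_neg (H : l2 X →L[ℂ] l2 X) : essSpectrum (-H) = -essSpectrum H := by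
  have key : ∀ (H : l2 X →L[ℂ] l2 X) (t : ℝ), t ∉ essSpectrum H → -t ∉ essSpectrum (-H) := by
    intro H t ht
    rw [essSpectrum, Set.mem_ofPred_eq, not_not] at ht ⊢
    obtain ⟨S, hl, hr⟩ := ht
    have h : -H - ((-t : ℝ) : ℂ) • 1 = -(H - (t : ℂ) • 1) := by
      rw [Complex.ofReal_neg, neg_smul]
      abel
    refine ⟨-S, ?_, ?_⟩
    · rwa [h, neg_mul_neg]
    · rwa [h, neg_mul_neg]
  ext t
  rw [Set.mem_neg]
  refine not_iff_not.1 ⟨fun h => ?_, fun h => ?_⟩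
  · simpa using key (-H) t h
  · simpa using key H (-t) h

theorem compressL2_neg (H : l2 X →L[ℂ] l2 X) (M : Set X) :
    compressL2 (-H) M = -compressL2 H M := by
  simp [compressL2]

variable [DecidableEq X]

theorem nontrivial_l2_of_finite_compl [Infinite X] {M : Set X} (hM : Mᶜ.Finite) :
    Nontrivial (l2 M) := by
  obtain ⟨x, hx⟩ := hM.infinite_compl.nonempty
  rw [compl_compl] at hx
  refine ⟨⟨lp.single 2 ⟨x, hx⟩ 1, 0, fun h => ?_⟩⟩
  have := congrArg norm h
  rw [lp.norm_single (by norm_num)] at this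
  simp at this

theorem essSpectrum_subset_spectrum_compressL2 (H : l2 X →L[ℂ] l2 X) {M : Set X}
    (hM : Mᶜ.Finite) : essSpectrum H ⊆ spectrum ℝ (compressL2 H M) := by
  intro t ht
  by_contra hts
  rw [spectrum.notMem_iff] at hts
  obtain ⟨u, hu⟩ := hts
  have hRJ : ∀ w, restrictL2 M ((H - (t : ℂ) • 1) (extendL2 M w)) =
      -(u : l2 M →L[ℂ] l2 M) w := by
    intro w
    rw [hu, sub_apply, sub_apply, map_sub, Algebra.algebraMap_eq_smul_one, smul_apply, smul_apply,
      one_apply_eq_self, one_apply_eq_self, map_smul, restrictL2_extendL2, Complex.coe_smul,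
      neg_sub]
    rfl
  have hl : ∀ w, (↑u⁻¹ : l2 M →L[ℂ] l2 M) ((u : l2 M →L[ℂ] l2 M) w) = w := fun w =>
    DFunLike.congr_fun u.inv_mul w
  have hr : ∀ w, (u : l2 M →L[ℂ] l2 M) ((↑u⁻¹ : l2 M →L[ℂ] l2 M) w) = w := fun w =>
    DFunLike.congr_fun u.mul_inv w
  refine ht (exists_inverse_mod_compact (R := restrictL2 M) (J := extendL2 M)
    (T := -(↑u⁻¹ : l2 M →L[ℂ] l2 M)) (fun w => ?_) (fun w => ?_)
    (isCompactOperator_one_sub_extendL2_restrictL2 hM))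
  · rw [hRJ, neg_apply, map_neg, neg_neg, hl]
  · rw [hRJ, neg_apply, map_neg, neg_neg, hr]

/-- A supremum of the bottoms of the spectra of the cofinite compressions admits a singular
Weyl sequence. -/
theorem exists_norm_sub_smul_le [Infinite X] {H : l2 X →L[ℂ] l2 X} (hH : IsSelfAdjoint H) {s : ℝ}
    (hs : IsLUB {t : ℝ | ∃ M : Set X, Mᶜ.Finite ∧ t = sInf (spectrum ℝ (compressL2 H M))} s)
    {η : ℝ} (hη : 0 < η) (F₀ : Finset X) :
    ∃ v : l2 X, ‖v‖ = 1 ∧ (∀ x ∈ F₀, v x = 0) ∧ ‖(H - (s : ℂ) • 1) v‖ ≤ η := by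
  set C : ℝ := ‖H‖ + |s| + 1
  have hC : 0 < C := by positivity
  obtain ⟨δ, hδ, hδ1, hδη, hδC⟩ : ∃ δ : ℝ, 0 < δ ∧ δ ≤ 1 ∧ δ ≤ η / 4 ∧
      C * (2 * δ) ≤ (η / 2) ^ 2 := by
    refine ⟨min 1 (min (η / 4) (η ^ 2 / (8 * C))), by positivity, min_le_left _ _,
      (min_le_right _ _).trans (min_le_left _ _), ?_⟩
    calc _ ≤ C * (2 * (η ^ 2 / (8 * C))) := by
          gcongr
          exact (min_le_right _ _).trans (min_le_right _ _)
      _ = _ := by field_simp; ring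
  obtain ⟨_, ⟨M, hM, rfl⟩, hsM⟩ := (lt_isLUB_iff hs).1 (sub_lt_self s hδ)
  obtain ⟨F₁, hF₁⟩ := IsCompactOperator.exists_finset_norm_apply_le
    (K := (1 - extendL2 M ∘L restrictL2 M) ∘L (H - (s : ℂ) • 1))
    (by
      rw [ContinuousLinearMap.coe_comp]
      exact (isCompactOperator_one_sub_extendL2_restrictL2 hM).comp_clm (H - (s : ℂ) • 1)) hδ
  set M' : Set X := M \ (F₀ ∪ F₁ : Finset X)
  have hM' : M'ᶜ.Finite := by
    rw [Set.compl_sdiff]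
    exact (Finset.finite_toSet _).union hM
  have := nontrivial_l2_of_finite_compl hM'
  obtain ⟨w, hw, hHw⟩ := exists_re_inner_lt (isSelfAdjoint_compressL2 hH M')
    ((hs.1 ⟨M', hM', rfl⟩).trans_lt (lt_add_of_pos_right s hδ))
  set v := extendL2 M' w
  have hv : ‖v‖ = 1 := by rw [norm_extendL2_apply, hw]
  have hvM' : ∀ x ∉ M', v x = 0 := fun x hx => extendL2_apply_notMem M' w hx
  have hvM : extendL2 M (restrictL2 M v) = v :=
    extendL2_restrictL2_of_support M fun x hx => hvM' x fun h => hx h.1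
  have hRv : ‖restrictL2 M v‖ = 1 := by rw [← norm_extendL2_apply, hvM, hv]
  refine ⟨v, hv, fun x hx => hvM' x fun h => h.2 (by simp [hx]), ?_⟩
  have hP := hF₁ v hv.le fun x hx => hvM' x fun h => h.2 (by simp [hx])
  have hHR : compressL2 H M (restrictL2 M v) = restrictL2 M (H v) := by
    rw [← congrArg H hvM]
    rfl
  have hC' : ‖compressL2 H M‖ + |s - δ| ≤ C := by
    have h1 : |s - δ| ≤ |s| + 1 := (abs_sub _ _).trans (by rw [abs_of_pos hδ]; linarith)
    linarith [norm_compressL2_le H M]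
  have hin : (⟪compressL2 H M (restrictL2 M v), restrictL2 M v⟫_ℂ).re - (s - δ) ≤ 2 * δ := by
    have h1 : ⟪compressL2 H M' w, w⟫_ℂ = ⟪H v, v⟫_ℂ := (inner_extendL2_right M' w (H v)).symm
    rw [h1] at hHw
    rw [hHR, ← inner_extendL2_right, hvM]
    linarith
  have hBη : ‖restrictL2 M (H v) - ((s - δ : ℝ) : ℂ) • restrictL2 M v‖ ≤ η / 2 := by
    have h1 := norm_sub_smul_sq_le (isSelfAdjoint_compressL2 hH M)
      (fun x hx => hsM.le.trans (csInf_le (bddBelow_spectrum _) hx)) hRv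
    refine (sq_le_sq₀ (norm_nonneg _) (by positivity)).1 ?_
    rw [← hHR]
    refine h1.trans ((mul_le_mul_of_nonneg_left hin (by positivity)).trans ?_)
    exact (mul_le_mul_of_nonneg_right hC' (by positivity)).trans hδC
  have hR : restrictL2 M ((H - (s : ℂ) • 1) v) =
      (restrictL2 M (H v) - ((s - δ : ℝ) : ℂ) • restrictL2 M v) - (δ : ℂ) • restrictL2 M v := by
    rw [sub_apply, smul_apply, one_apply_eq_self, map_sub, map_smul, Complex.ofReal_sub]
    module
  have hRη : ‖restrictL2 M ((H - (s : ℂ) • 1) v)‖ ≤ η / 2 + δ := by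
    rw [hR]
    refine (norm_sub_le _ _).trans (add_le_add hBη ?_)
    rw [norm_smul, hRv, mul_one, Complex.norm_real, Real.norm_eq_abs, abs_of_pos hδ]
  have hdecomp : (H - (s : ℂ) • 1) v = (1 - extendL2 M ∘L restrictL2 M) ((H - (s : ℂ) • 1) v) +
      extendL2 M (restrictL2 M ((H - (s : ℂ) • 1) v)) := by
    rw [sub_apply (1 : l2 X →L[ℂ] l2 X)]
    exact (sub_add_cancel _ _).symm
  rw [hdecomp]
  refine (norm_add_le _ _).trans ?_
  rw [norm_extendL2_apply]
  have : ‖(1 - extendL2 M ∘L restrictL2 M) ((H - (s : ℂ) • 1) v)‖ ≤ δ := hP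
  linarith

theorem isLUB_mem_essSpectrum [Infinite X] {H : l2 X →L[ℂ] l2 X} (hH : IsSelfAdjoint H) {s : ℝ}
    (hs : IsLUB {t : ℝ | ∃ M : Set X, Mᶜ.Finite ∧ t = sInf (spectrum ℝ (compressL2 H M))} s) :
    s ∈ essSpectrum H := by
  rintro ⟨S, hS, -⟩
  obtain ⟨F, hF⟩ := hS.exists_finset_norm_apply_le (ε := 1 / 4) (by norm_num)
  obtain ⟨v, hv, hvF, hHv⟩ := exists_norm_sub_smul_le hH hs
    (η := 1 / (4 * (‖S‖ + 1))) (by positivity) F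
  have h1 := hF v hv.le hvF
  have h2 : ‖S ((H - (s : ℂ) • 1) v)‖ ≤ 1 / 4 := by
    calc _ ≤ ‖S‖ * (1 / (4 * (‖S‖ + 1))) := S.le_opNorm_of_le hHv
      _ ≤ (‖S‖ + 1) * (1 / (4 * (‖S‖ + 1))) := by gcongr; linarith
      _ = 1 / 4 := by field_simp
  have h3 : v = S ((H - (s : ℂ) • 1) v) - (S * (H - (s : ℂ) • 1) - 1) v := by simp
  have h4 : ‖v‖ ≤ 1 / 4 + 1 / 4 := by
    conv_lhs => rw [h3]
    exact (norm_sub_le _ _).trans (add_le_add h2 h1)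
  norm_num [hv] at h4

theorem sInf_essSpectrum [Infinite X] {H : l2 X →L[ℂ] l2 X} (hH : IsSelfAdjoint H) :
    sInf (essSpectrum H) =
      sSup {t : ℝ | ∃ M : Set X, Mᶜ.Finite ∧ t = sInf (spectrum ℝ (compressL2 H M))} := by
  set A := {t : ℝ | ∃ M : Set X, Mᶜ.Finite ∧ t = sInf (spectrum ℝ (compressL2 H M))}
  have hne : A.Nonempty := ⟨_, Set.univ, by simp, rfl⟩
  have hbdd : BddAbove A := by
    refine ⟨‖H‖, ?_⟩
    rintro t ⟨M, hM, rfl⟩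
    have := nontrivial_l2_of_finite_compl hM
    exact (sInf_spectrum_le_norm (isSelfAdjoint_compressL2 hH M)).trans (norm_compressL2_le H M)
  have hlub := isLUB_csSup hne hbdd
  have hmem := isLUB_mem_essSpectrum hH hlub
  refine (IsLeast.csInf_eq ⟨hmem, fun x hx => csSup_le hne ?_⟩)
  rintro t ⟨M, hM, rfl⟩
  exact csInf_le (bddBelow_spectrum _) (essSpectrum_subset_spectrum_compressL2 H hM hx)

theorem sSup_essSpectrum [Infinite X] {H : l2 X →L[ℂ] l2 X} (hH : IsSelfAdjoint H) :
    sSup (essSpectrum H) =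
      sInf {t : ℝ | ∃ M : Set X, Mᶜ.Finite ∧ t = sSup (spectrum ℝ (compressL2 H M))} := by
  have h := sInf_essSpectrum hH.neg
  have hset : {t : ℝ | ∃ M : Set X, Mᶜ.Finite ∧ t = sInf (spectrum ℝ (compressL2 (-H) M))} =
      -{t : ℝ | ∃ M : Set X, Mᶜ.Finite ∧ t = sSup (spectrum ℝ (compressL2 H M))} := by
    ext t
    simp only [compressL2_neg, ← spectrum.neg_eq, Real.sInf_def, neg_neg, Set.mem_neg,
      Set.mem_ofPred_eq, neg_eq_iff_eq_neg]
  rw [essSpectrum_neg, hset, Real.sInf_def, neg_neg] at h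
  rw [Real.sInf_def, ← h, neg_neg]

end Persson

/-- **Persson's formula for band-dominated operators** (Theorem 1.2 of the paper).
Let `(X₀, δ)` be an infinite countable uniformly discrete metric space with bounded geometry
satisfying Yu's Property A, and let `H` be a self-adjoint band-dominated operator on `ℓ²(X₀)`.
For each cofinite `M₀ ⊆ X₀` let `H_{M₀}` be the compression of `H` to `ℓ²(M₀)`, given by the
restricted matrix. Then `inf sp_ess(H) = sup_{M₀} inf sp(H_{M₀})` and
`sup sp_ess(H) = inf_{M₀} sup sp(H_{M₀})`. -/
theorem persson_band_dominated
    (X₀ : Type) [MetricSpace X₀] [Countable X₀] [Infinite X₀] [DecidableEq X₀]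
    -- uniform discreteness
    (hUD : ∃ α > (0 : ℝ), ∀ x y : X₀, x ≠ y → α ≤ dist x y)
    -- bounded geometry
    (hBG : ∀ r > (0 : ℝ), ∃ N : ℕ, ∀ x : X₀,
      (Metric.closedBall x r).Finite ∧ (Metric.closedBall x r).ncard ≤ N)
    -- Yu's Property A
    (hA : ∃ K : ℕ → X₀ → X₀ → ℝ,
      (∀ n (s : Finset X₀) (c : X₀ → ℝ),
        0 ≤ ∑ i ∈ s, ∑ j ∈ s, c i * c j * K n i j) ∧
      (∀ n, ∃ C : ℝ, ∀ x y : X₀, |K n x y| ≤ C) ∧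
      (∀ n, ∃ r : ℝ, ∀ x y : X₀, dist x y > r → K n x y = 0) ∧
      (∀ r > (0 : ℝ), ∀ ε > (0 : ℝ), ∃ n₀ : ℕ, ∀ n ≥ n₀, ∀ x y : X₀,
        dist x y ≤ r → |K n x y - 1| ≤ ε))
    (H : l2 X₀ →L[ℂ] l2 X₀)
    (hH : IsBandDominated H) (hsa : IsSelfAdjoint H)
    -- the compressions, characterized by their matrix formula
    (HM : (M₀ : Set X₀) → M₀ᶜ.Finite → (l2 ↥M₀ →L[ℂ] l2 ↥M₀))
    (hHM : ∀ (M₀ : Set X₀) (hM : M₀ᶜ.Finite) (v : l2 ↥M₀) (a : ↥M₀),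
      (HM M₀ hM v) a = ∑' b : ↥M₀, matrixEntry H ↑a ↑b * v b) :
    sInf (essSpectrum H)
        = sSup {t : ℝ | ∃ (M₀ : Set X₀) (hM : M₀ᶜ.Finite),
            t = sInf (spectrum ℝ (HM M₀ hM))} ∧
    sSup (essSpectrum H)
        = sInf {t : ℝ | ∃ (M₀ : Set X₀) (hM : M₀ᶜ.Finite),
            t = sSup (spectrum ℝ (HM M₀ hM))} := by
  have hcomp : ∀ (M : Set X₀) (hM : Mᶜ.Finite), HM M hM = compressL2 H M := by
    intro M hM
    ext v a
    rw [hHM, compressL2_apply_eq_tsum]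
  have hset : ∀ f : (M : Set X₀) → (l2 M →L[ℂ] l2 M) → ℝ,
      {t : ℝ | ∃ (M : Set X₀) (hM : Mᶜ.Finite), t = f M (HM M hM)} =
        {t : ℝ | ∃ M : Set X₀, Mᶜ.Finite ∧ t = f M (compressL2 H M)} := by
    intro f
    ext t
    refine exists_congr fun M => ⟨?_, ?_⟩
    · rintro ⟨hM, rfl⟩
      exact ⟨hM, by rw [hcomp M hM]⟩
    · rintro ⟨hM, rfl⟩
      exact ⟨hM, by rw [hcomp M hM]⟩
  rw [hset fun M A => sInf (spectrum ℝ A), hset fun M A => sSup (spectrum ℝ A)]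
  exact ⟨sInf_essSpectrum hsa, sSup_essSpectrum hsa⟩

end
end

section
/- Let X ⊆ 𝒜^ℤ be a bi-sided subshift, X_∞ ⊆ X a nonempty closed τ-invariant subset, and (M_i)_{i∈I} a net of clopen subsets of X such that X_∞ ⊆ M_i for every i and M_i converges to X_∞ in the Fell topology; equivalently (since X_∞ ⊆ M_i), for every compact K ⊆ X with K ∩ X_∞ = ∅ one eventually has M_i ∩ K = ∅. Let h : X × ℤ → ℂ be continuous with compact support and self-adjoint. Then inf_{x∈X_∞} inf sp(H_x^{X_∞}) = sup_{i∈I} [ inf_{y∈M_i} inf sp(H_y^{M_i}) ] and sup_{x∈X_∞} sup sp(H_x^{X_∞}) = inf_{i∈I} [ sup_{y∈M_i} sup sp(H_y^{M_i}) ]. -/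
open scoped ENNReal

noncomputable section

/-- The shift action of `ℤ` on `𝒜^ℤ`: `(τ_k x)(n) = x(n - k)`. -/
def tau {𝒜 : Type} (k : ℤ) (x : ℤ → 𝒜) : ℤ → 𝒜 := fun n => x (n - k)

/-- A self-adjoint operator has spectrum bounded below by `c` iff its quadratic form is. -/
theorem IsSelfAdjoint.le_sInf_spectrum_iff {E : Type*} [NormedAddCommGroup E]
    [InnerProductSpace ℂ E] [CompleteSpace E] [Nontrivial E] {T : E →L[ℂ] E}
    (hT : IsSelfAdjoint T) (c : ℝ) :
    c ≤ sInf (spectrum ℝ T) ↔ ∀ v : E, c * ‖v‖ ^ 2 ≤ (inner ℂ v (T v)).re := by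
  have hne : (spectrum ℝ T).Nonempty := ContinuousFunctionalCalculus.spectrum_nonempty T hT
  have hbdd : BddBelow (spectrum ℝ T) := (spectrum.isCompact T).bddBelow
  rw [le_csInf_iff hbdd hne]
  have key : algebraMap ℝ (E →L[ℂ] E) c ≤ T ↔ ∀ x ∈ spectrum ℝ T, c ≤ x :=
    algebraMap_le_iff_le_spectrum (a := T) (ha := hT)
  rw [← key, ContinuousLinearMap.le_def, ContinuousLinearMap.isPositive_def']
  have hsa : IsSelfAdjoint (T - algebraMap ℝ (E →L[ℂ] E) c) :=
    hT.sub ((IsSelfAdjoint.all c).algebraMap _)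
  simp only [hsa, true_and]
  refine forall_congr' fun v => ?_
  have : (T - algebraMap ℝ (E →L[ℂ] E) c).reApplyInnerSelf v
      = (inner ℂ v (T v)).re - c * ‖v‖ ^ 2 := by
    rw [ContinuousLinearMap.reApplyInnerSelf_apply, inner_re_symm]
    simp only [Algebra.algebraMap_eq_smul_one, sub_apply,
      smul_apply, one_apply_eq_self, inner_sub_right,
      inner_smul_right_eq_smul, map_sub, RCLike.re_to_complex, Complex.real_smul,
      inner_self_eq_norm_sq_to_K]
    simp [← Complex.ofReal_pow]
  rw [this, sub_nonneg]

/-- The real part of the form of the matrix `A`, evaluated on the restriction of `w` to `S`. -/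
def quadForm {J : Type*} (A : J → J → ℂ) (S : Finset J) (w : J → ℂ) : ℝ :=
  (∑ k ∈ S, ∑ l ∈ S, star (w k) * A k l * w l).re

theorem quadForm_congr {J : Type*} {A : J → J → ℂ} {S : Finset J} {w w' : J → ℂ}
    (hw : ∀ k ∈ S, w k = w' k) : quadForm A S w = quadForm A S w' := by
  unfold quadForm
  congr 1
  refine Finset.sum_congr rfl fun k hk => Finset.sum_congr rfl fun l hl => ?_
  rw [hw k hk, hw l hl]

theorem quadForm_map {J K : Type*} (f : K ↪ J) (A : J → J → ℂ) (S : Finset K) (w : J → ℂ) :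
    quadForm A (S.map f) w = quadForm (fun k l => A (f k) (f l)) S (fun k => w (f k)) := by
  simp [quadForm, Finset.sum_map]

theorem quadForm_filter {J : Type*} (A : J → J → ℂ) (S : Finset J) (w : J → ℂ)
    (p : J → Prop) [DecidablePred p] :
    quadForm A (S.filter p) w =
      (∑ k ∈ S, ∑ l ∈ S, if p k ∧ p l then star (w k) * A k l * w l else 0).re := by
  simp only [quadForm, Finset.sum_filter, ite_and]
  congr 1
  refine Finset.sum_congr rfl fun k _ => ?_
  split_ifs <;> simp

section MatrixOperator

variable {J : Type*} {T : lp (fun _ : J => ℂ) 2 →L[ℂ] lp (fun _ : J => ℂ) 2} {A : J → J → ℂ}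

theorem lp_nontrivial [Nonempty J] : Nontrivial (lp (fun _ : J => ℂ) 2) := by
  classical
  obtain ⟨j⟩ := ‹Nonempty J›
  refine ⟨lp.single 2 j 1, 0, fun h => ?_⟩
  simpa using congrArg (fun f : lp (fun _ : J => ℂ) 2 => f j) h

open Classical in
theorem apply_single_of_matrix
    (hT : ∀ v k, (T v) k = ∑' l, A k l * v l) (l : J) (a : ℂ) (k : J) :
    (T (lp.single 2 l a)) k = A k l * a := by
  rw [hT, tsum_eq_single l]
  · simp
  · intro m hm
    simp [hm]

open Classical in
theorem dense_span_single :
    Dense (Submodule.span ℂ (Set.range fun l : J =>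
      (lp.single 2 l 1 : lp (fun _ : J => ℂ) 2)) : Set (lp (fun _ : J => ℂ) 2)) := by
  intro v
  have hv := lp.hasSum_single (p := 2) (by simp) v
  refine mem_closure_of_tendsto hv (Filter.Eventually.of_forall fun S => ?_)
  refine Submodule.sum_mem _ fun k _ => ?_
  have : (lp.single 2 k (v k) : lp (fun _ : J => ℂ) 2) = v k • lp.single 2 k 1 := by
    rw [← lp.single_smul]; simp
  rw [this]
  exact Submodule.smul_mem _ _ (Submodule.subset_span ⟨k, rfl⟩)

theorem isSelfAdjoint_of_matrix (hA : ∀ k l, star (A k l) = A l k)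
    (hT : ∀ v k, (T v) k = ∑' l, A k l * v l) : IsSelfAdjoint T := by
  classical
  rw [ContinuousLinearMap.isSelfAdjoint_iff']
  refine ContinuousLinearMap.ext_on dense_span_single ?_
  rintro _ ⟨l, rfl⟩
  refine lp.ext (funext fun k => ?_)
  have h1 : ((ContinuousLinearMap.adjoint T) (lp.single 2 l 1)) k
      = inner ℂ (lp.single 2 k (1 : ℂ) : lp (fun _ : J => ℂ) 2)
        ((ContinuousLinearMap.adjoint T) (lp.single 2 l 1)) := by
    rw [lp.inner_single_left]; simp
  rw [h1, ContinuousLinearMap.adjoint_inner_right, ← inner_conj_symm, lp.inner_single_left,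
    apply_single_of_matrix hT, apply_single_of_matrix hT, ← hA l k]
  simp

open Classical in
theorem re_inner_sum_single (hT : ∀ v k, (T v) k = ∑' l, A k l * v l)
    (S : Finset J) (w : J → ℂ) :
    (inner ℂ (∑ k ∈ S, lp.single 2 k (w k) : lp (fun _ : J => ℂ) 2)
      (T (∑ k ∈ S, lp.single 2 k (w k)))).re = quadForm A S w := by
  rw [quadForm, map_sum, sum_inner]
  congr 1
  refine Finset.sum_congr rfl fun k _ => ?_
  rw [inner_sum]
  refine Finset.sum_congr rfl fun l _ => ?_
  rw [lp.inner_single_left, apply_single_of_matrix hT]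
  simp only [RCLike.inner_apply, ← Complex.star_def]
  ring

open Classical in
theorem norm_sq_sum_single (S : Finset J) (w : J → ℂ) :
    ‖(∑ k ∈ S, lp.single 2 k (w k) : lp (fun _ : J => ℂ) 2)‖ ^ 2 = ∑ k ∈ S, ‖w k‖ ^ 2 := by
  have := lp.norm_sum_single (p := 2) (E := fun _ : J => ℂ) (by simp) w S
  simpa using this

theorem le_sInf_spectrum_iff_of_matrix [Nonempty J] (hA : ∀ k l, star (A k l) = A l k)
    (hT : ∀ v k, (T v) k = ∑' l, A k l * v l) (c : ℝ) :
    c ≤ sInf (spectrum ℝ T) ↔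
      ∀ (S : Finset J) (w : J → ℂ), c * ∑ k ∈ S, ‖w k‖ ^ 2 ≤ quadForm A S w := by
  classical
  have := lp_nontrivial (J := J)
  refine ((isSelfAdjoint_of_matrix hA hT).le_sInf_spectrum_iff c).trans ⟨?_, ?_⟩
  · intro h S w
    rw [← re_inner_sum_single hT, ← norm_sq_sum_single]
    exact h _
  · intro h v
    have hv := lp.hasSum_single (p := 2) (by simp) v
    have h1 : Continuous fun u : lp (fun _ : J => ℂ) 2 => c * ‖u‖ ^ 2 := by fun_prop
    have h2 : Continuous fun u : lp (fun _ : J => ℂ) 2 => (inner ℂ u (T u)).re :=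
      Complex.continuous_re.comp (continuous_id.inner T.continuous)
    refine le_of_tendsto_of_tendsto' ((h1.tendsto v).comp hv) ((h2.tendsto v).comp hv) fun S => ?_
    simp only [Function.comp_apply]
    rw [re_inner_sum_single hT, norm_sq_sum_single]
    exact h S _

theorem le_sInf_spectrum_iff_of_matrix_subtype {P : J → Prop} [Nonempty {k // P k}]
    {T : lp (fun _ : {k // P k} => ℂ) 2 →L[ℂ] lp (fun _ : {k // P k} => ℂ) 2}
    (hA : ∀ k l, star (A k l) = A l k)
    (hT : ∀ v k, (T v) k = ∑' l : {k // P k}, A k l * v l) (c : ℝ) :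
    c ≤ sInf (spectrum ℝ T) ↔
      ∀ S : Finset J, (∀ k ∈ S, P k) → ∀ w : J → ℂ,
        c * ∑ k ∈ S, ‖w k‖ ^ 2 ≤ quadForm A S w := by
  classical
  rw [le_sInf_spectrum_iff_of_matrix (A := fun k l : {k // P k} => A k l)
    (fun k l => hA k l) hT]
  constructor
  · intro h S hS w
    rw [← Finset.subtype_map_of_mem hS, quadForm_map, Finset.sum_map]
    exact h _ _
  · intro h S w
    set u : J → ℂ := fun k => if hk : P k then w ⟨k, hk⟩ else 0 with hu
    have huw : ∀ k : {k // P k}, u k = w k := fun k => by simp [hu, k.2]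
    have := h (S.map (Function.Embedding.subtype P)) (fun k hk => by
      obtain ⟨j, _, rfl⟩ := Finset.mem_map.mp hk
      exact j.2) u
    rw [quadForm_map, Finset.sum_map] at this
    simpa only [Function.Embedding.subtype_apply, huw] using this

end MatrixOperator

section Banded

variable {A : ℤ → ℤ → ℂ} {C : ℝ} {r : ℕ}

/-- The Schur test for a banded matrix. -/
theorem abs_quadForm_le (hC : 0 ≤ C) (hA : ∀ k l, ‖A k l‖ ≤ C)
    (hband : ∀ k l, (r : ℤ) < |k - l| → A k l = 0) (S : Finset ℤ) (w : ℤ → ℂ) :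
    |quadForm A S w| ≤ C * (2 * r + 1) * ∑ k ∈ S, ‖w k‖ ^ 2 := by
  have hcard : ∀ k : ℤ, ((S.filter fun l => |k - l| ≤ (r : ℤ)).card : ℝ) ≤ 2 * r + 1 := by
    intro k
    have hsub : (S.filter fun l => |k - l| ≤ (r : ℤ)) ⊆ Finset.Icc (k - r) (k + r) := by
      intro l hl
      simp only [Finset.mem_filter, abs_le] at hl
      simp only [Finset.mem_Icc]
      omega
    have := Finset.card_le_card hsub
    rw [Int.card_Icc] at this
    have h2 : (S.filter fun l => |k - l| ≤ (r : ℤ)).card ≤ 2 * r + 1 := by omega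
    exact_mod_cast h2
  have hterm : ∀ k l, ‖star (w k) * A k l * w l‖ ≤
      C / 2 * (if |k - l| ≤ (r : ℤ) then ‖w k‖ ^ 2 else 0)
        + C / 2 * (if |l - k| ≤ (r : ℤ) then ‖w l‖ ^ 2 else 0) := by
    intro k l
    rw [abs_sub_comm l k]
    split_ifs with hkl
    · rw [norm_mul, norm_mul, norm_star]
      have h1 : ‖w k‖ * ‖A k l‖ * ‖w l‖ ≤ C * (‖w k‖ * ‖w l‖) := by
        have := mul_le_mul_of_nonneg_right (hA k l)
          (mul_nonneg (norm_nonneg (w k)) (norm_nonneg (w l)))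
        linarith
      nlinarith [mul_nonneg hC (sq_nonneg (‖w k‖ - ‖w l‖))]
    · rw [hband k l (not_le.mp hkl)]
      simp
  have hrow : ∑ k ∈ S, ∑ l ∈ S, (if |k - l| ≤ (r : ℤ) then ‖w k‖ ^ 2 else 0)
      ≤ (2 * r + 1) * ∑ k ∈ S, ‖w k‖ ^ 2 := by
    rw [Finset.mul_sum]
    refine Finset.sum_le_sum fun k _ => ?_
    rw [← Finset.sum_filter, Finset.sum_const, nsmul_eq_mul]
    exact mul_le_mul_of_nonneg_right (hcard k) (sq_nonneg _)
  calc |quadForm A S w| ≤ ‖∑ k ∈ S, ∑ l ∈ S, star (w k) * A k l * w l‖ := Complex.abs_re_le_norm _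
    _ ≤ ∑ k ∈ S, ∑ l ∈ S, ‖star (w k) * A k l * w l‖ :=
        (norm_sum_le _ _).trans (Finset.sum_le_sum fun k _ => norm_sum_le _ _)
    _ ≤ ∑ k ∈ S, ∑ l ∈ S, (C / 2 * (if |k - l| ≤ (r : ℤ) then ‖w k‖ ^ 2 else 0)
        + C / 2 * (if |l - k| ≤ (r : ℤ) then ‖w l‖ ^ 2 else 0)) :=
        Finset.sum_le_sum fun k _ => Finset.sum_le_sum fun l _ => hterm k l
    _ = C * ∑ k ∈ S, ∑ l ∈ S, (if |k - l| ≤ (r : ℤ) then ‖w k‖ ^ 2 else 0) := by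
        simp only [Finset.sum_add_distrib, ← Finset.mul_sum]
        rw [Finset.sum_comm (f := fun k l => if |l - k| ≤ (r : ℤ) then ‖w l‖ ^ 2 else 0)]
        ring
    _ ≤ C * ((2 * r + 1) * ∑ k ∈ S, ‖w k‖ ^ 2) := mul_le_mul_of_nonneg_left hrow hC
    _ = _ := by ring

/-- The indices of `S` in the window `[m, m + R)`. -/
def window (S : Finset ℤ) (R : ℕ) (m : ℤ) : Finset ℤ := S.filter fun k => m ≤ k ∧ k < m + R

/-- The number of windows of length `R` that contain both `k` and `l`. -/
def overlap (R : ℕ) (k l : ℤ) : ℕ := (min k l - max k l + R).toNat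

theorem exists_windows (S : Finset ℤ) (R : ℕ) : ∃ D : Finset ℤ, ∀ k ∈ S, ∀ l ∈ S,
    (D.filter fun m => (m ≤ k ∧ k < m + R) ∧ (m ≤ l ∧ l < m + R)).card = overlap R k l := by
  refine ⟨S.biUnion fun k => Finset.Ioc (k - R) k, fun k hk l _ => ?_⟩
  have : ((S.biUnion fun k => Finset.Ioc (k - R) k).filter
      fun m => (m ≤ k ∧ k < m + R) ∧ (m ≤ l ∧ l < m + R))
      = Finset.Ioc (max k l - R) (min k l) := by
    ext m
    simp only [Finset.mem_filter, Finset.mem_biUnion, Finset.mem_Ioc]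
    constructor
    · omega
    · intro h
      exact ⟨⟨k, hk, by omega⟩, by omega⟩
  rw [this, Int.card_Ioc, overlap]
  congr 1
  ring

theorem abs_sub_overlap_le (R : ℕ) (k l : ℤ) :
    |(R : ℝ) - overlap R k l| ≤ (|k - l| : ℤ) := by
  have : |(R : ℤ) - overlap R k l| ≤ |k - l| := by
    unfold overlap
    rw [abs_le]
    rcases le_total k l with h | h
    · rw [min_eq_left h, max_eq_right h, abs_of_nonpos (by omega)]; omega
    · rw [min_eq_right h, max_eq_left h, abs_of_nonneg (by omega)]; omega
  exact_mod_cast this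

/-- A localization estimate: a lower bound of the form on all windows of length `R` is a lower
bound up to an error of order `1 / R`. -/
theorem le_quadForm_of_window (hC : 0 ≤ C) (hA : ∀ k l, ‖A k l‖ ≤ C)
    (hband : ∀ k l, (r : ℤ) < |k - l| → A k l = 0) (S : Finset ℤ) (w : ℤ → ℂ)
    {R : ℕ} (hR : 0 < R) {c : ℝ}
    (hloc : ∀ m, c * ∑ k ∈ window S R m, ‖w k‖ ^ 2 ≤ quadForm A (window S R m) w) :
    (c - r * C * (2 * r + 1) / R) * ∑ k ∈ S, ‖w k‖ ^ 2 ≤ quadForm A S w := by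
  obtain ⟨D, hD⟩ := exists_windows S R
  have hform : ∑ m ∈ D, quadForm A (window S R m) w
      = (∑ k ∈ S, ∑ l ∈ S, (overlap R k l : ℂ) * (star (w k) * A k l * w l)).re := by
    simp only [window, quadForm_filter]
    rw [← Complex.re_sum, Finset.sum_comm]
    congr 1
    refine Finset.sum_congr rfl fun k hk => ?_
    rw [Finset.sum_comm]
    refine Finset.sum_congr rfl fun l hl => ?_
    rw [← Finset.sum_filter, Finset.sum_const, hD k hk l hl, nsmul_eq_mul]
  have hnorm : ∑ m ∈ D, ∑ k ∈ window S R m, ‖w k‖ ^ 2 = R * ∑ k ∈ S, ‖w k‖ ^ 2 := by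
    simp only [window, Finset.sum_filter]
    rw [Finset.sum_comm, Finset.mul_sum]
    refine Finset.sum_congr rfl fun k hk => ?_
    have h1 := hD k hk k hk
    simp only [and_self] at h1
    rw [← Finset.sum_filter, Finset.sum_const, h1, nsmul_eq_mul]
    simp [overlap]
  have herr : R * quadForm A S w - ∑ m ∈ D, quadForm A (window S R m) w
      = quadForm (fun k l => ((R : ℂ) - overlap R k l) * A k l) S w := by
    rw [hform]
    simp only [quadForm]
    rw [← Complex.re_ofReal_mul, ← Complex.sub_re]
    congr 1
    rw [Finset.mul_sum, ← Finset.sum_sub_distrib]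
    refine Finset.sum_congr rfl fun k _ => ?_
    rw [Finset.mul_sum, ← Finset.sum_sub_distrib]
    refine Finset.sum_congr rfl fun l _ => ?_
    push_cast
    ring
  have hB : ∀ k l, ‖((R : ℂ) - overlap R k l) * A k l‖ ≤ r * C := by
    intro k l
    by_cases hkl : (r : ℤ) < |k - l|
    · rw [hband k l hkl]
      simp only [mul_zero, norm_zero]
      positivity
    · have h1 : ‖(R : ℂ) - overlap R k l‖ ≤ r := by
        have h2 := abs_sub_overlap_le R k l
        have h3 : ((|k - l| : ℤ) : ℝ) ≤ r := by exact_mod_cast not_lt.mp hkl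
        have h4 : ‖(R : ℂ) - overlap R k l‖ = |(R : ℝ) - overlap R k l| := by
          rw [← Real.norm_eq_abs, ← Complex.norm_real]
          push_cast
          rfl
        linarith
      rw [norm_mul]
      exact mul_le_mul h1 (hA k l) (norm_nonneg _) (by positivity)
  have h1 := abs_quadForm_le (by positivity) hB
    (fun k l hkl => by rw [hband k l hkl, mul_zero]) S w
  rw [← herr, abs_le] at h1
  have h2 : c * (R * ∑ k ∈ S, ‖w k‖ ^ 2) ≤ ∑ m ∈ D, quadForm A (window S R m) w := by
    rw [← hnorm, Finset.mul_sum]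
    exact Finset.sum_le_sum fun m _ => hloc m
  have hR' : (0 : ℝ) < R := by exact_mod_cast hR
  rw [← mul_le_mul_iff_right₀ hR']
  have h3 : (R : ℝ) * ((c - r * C * (2 * r + 1) / R) * ∑ k ∈ S, ‖w k‖ ^ 2)
      = c * (R * ∑ k ∈ S, ‖w k‖ ^ 2) - r * C * (2 * r + 1) * ∑ k ∈ S, ‖w k‖ ^ 2 := by
    field_simp
  rw [h3]
  linarith [h1.1]

end Banded

section Subshift

variable {𝒜 : Type} {h : (ℤ → 𝒜) → ℤ → ℂ} {X Xinf : Set (ℤ → 𝒜)}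

theorem tau_tau (k l : ℤ) (x : ℤ → 𝒜) : tau k (tau l x) = tau (k + l) x := by
  funext n
  simp only [tau]
  congr 1
  ring

theorem tau_zero (x : ℤ → 𝒜) : tau 0 x = x := by
  funext n
  simp [tau]

theorem continuous_tau [TopologicalSpace 𝒜] (k : ℤ) :
    Continuous (tau k : (ℤ → 𝒜) → ℤ → 𝒜) :=
  continuous_pi fun n => continuous_apply (n - k)

/-- The matrix of the operator `H_y` on `ℓ²(ℤ)`. -/
def hopMatrix (h : (ℤ → 𝒜) → ℤ → ℂ) (y : ℤ → 𝒜) (k l : ℤ) : ℂ := h (tau l y) (k - l)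

theorem star_hopMatrix (hXinv : ∀ (k : ℤ), ∀ x ∈ X, tau k x ∈ X)
    (hsa : ∀ x ∈ X, ∀ k : ℤ, h (tau k x) (-k) = starRingEnd ℂ (h x k))
    {y : ℤ → 𝒜} (hy : y ∈ X) (k l : ℤ) : star (hopMatrix h y k l) = hopMatrix h y l k := by
  have := hsa (tau l y) (hXinv l y hy) (k - l)
  rw [tau_tau, sub_add_cancel, neg_sub] at this
  exact this.symm

theorem hopMatrix_tau (y : ℤ → 𝒜) (j k l : ℤ) :
    hopMatrix h (tau j y) k l = hopMatrix h y (k + j) (l + j) := by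
  simp only [hopMatrix, tau_tau]
  congr 1
  ring

theorem exists_norm_le [TopologicalSpace 𝒜] (hX : IsCompact X)
    (hcont : ∀ k : ℤ, ContinuousOn (fun x => h x k) X) {r : ℕ}
    (hsupp : ∀ (x : ℤ → 𝒜) (k : ℤ), (r : ℤ) < |k| → h x k = 0) :
    ∃ C, 0 ≤ C ∧ ∀ x ∈ X, ∀ k, ‖h x k‖ ≤ C := by
  choose B hB using fun k => hX.exists_bound_of_continuousOn (hcont k)
  refine ⟨∑ k ∈ Finset.Icc (-(r : ℤ)) r, |B k|,
    Finset.sum_nonneg fun _ _ => abs_nonneg _, fun x hx k => ?_⟩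
  by_cases hk : (r : ℤ) < |k|
  · rw [hsupp x k hk, norm_zero]
    exact Finset.sum_nonneg fun _ _ => abs_nonneg _
  · refine ((hB k x hx).trans (le_abs_self _)).trans
      (Finset.single_le_sum (f := fun k => |B k|) (fun _ _ => abs_nonneg _) ?_)
    rw [Finset.mem_Icc, ← abs_le]
    exact not_lt.mp hk

theorem continuousOn_quadForm_hopMatrix [TopologicalSpace 𝒜]
    (hXinv : ∀ (k : ℤ), ∀ x ∈ X, tau k x ∈ X)
    (hcont : ∀ k : ℤ, ContinuousOn (fun x => h x k) X) (S : Finset ℤ) :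
    ContinuousOn (fun p : (ℤ → 𝒜) × (ℤ → ℂ) => quadForm (hopMatrix h p.1) S p.2)
      (X ×ˢ Set.univ) := by
  refine Complex.continuous_re.comp_continuousOn ?_
  refine continuousOn_finsetSum _ fun k _ => continuousOn_finsetSum _ fun l _ => ?_
  have h1 : ContinuousOn (fun p : (ℤ → 𝒜) × (ℤ → ℂ) => h (tau l p.1) (k - l))
      (X ×ˢ Set.univ) :=
    (hcont (k - l)).comp ((continuous_tau l).comp continuous_fst).continuousOn
      fun p hp => hXinv l _ hp.1
  have h2 : Continuous fun p : (ℤ → 𝒜) × (ℤ → ℂ) => star (p.2 k) :=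
    continuous_star.comp ((continuous_apply k).comp continuous_snd)
  have h3 : Continuous fun p : (ℤ → 𝒜) × (ℤ → ℂ) => p.2 l :=
    (continuous_apply l).comp continuous_snd
  exact (h2.continuousOn.mul h1).mul h3.continuousOn

theorem quadForm_smul {J : Type*} (A : J → J → ℂ) (S : Finset J) (w : J → ℂ) (t : ℝ) :
    quadForm A S (fun k => (t : ℂ) * w k) = t ^ 2 * quadForm A S w := by
  unfold quadForm
  rw [← Complex.re_ofReal_mul, Finset.mul_sum]
  congr 1
  refine Finset.sum_congr rfl fun k _ => ?_
  rw [Finset.mul_sum]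
  refine Finset.sum_congr rfl fun l _ => ?_
  simp only [star_mul', Complex.star_def, Complex.conj_ofReal]
  push_cast
  ring

theorem sum_norm_sq_smul {J : Type*} (S : Finset J) (w : J → ℂ) (t : ℝ) :
    ∑ k ∈ S, ‖(t : ℂ) * w k‖ ^ 2 = t ^ 2 * ∑ k ∈ S, ‖w k‖ ^ 2 := by
  simp [mul_pow, Finset.mul_sum]

/-- A strict lower bound on the forms over `Xinf`, tested on a fixed finite set, persists on
all points outside a compact set disjoint from `Xinf`. -/
theorem exists_isCompact_lt_quadForm [TopologicalSpace 𝒜] [DiscreteTopology 𝒜]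
    (hX : IsCompact X) (hXinv : ∀ (k : ℤ), ∀ x ∈ X, tau k x ∈ X)
    (hcont : ∀ k : ℤ, ContinuousOn (fun x => h x k) X) {c E : ℝ} (hcE : c < E)
    (S : Finset ℤ)
    (hE : ∀ x ∈ Xinf, ∀ w : ℤ → ℂ, E * ∑ k ∈ S, ‖w k‖ ^ 2 ≤ quadForm (hopMatrix h x) S w) :
    ∃ K ⊆ X, IsCompact K ∧ K ∩ Xinf = ∅ ∧ ∀ y ∈ X, y ∉ K → ∀ w : ℤ → ℂ,
      c * ∑ k ∈ S, ‖w k‖ ^ 2 ≤ quadForm (hopMatrix h y) S w := by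
  set W : Set (ℤ → ℂ) := Set.univ.pi (fun _ => Metric.closedBall 0 1) ∩
    {w | ∑ k ∈ S, ‖w k‖ ^ 2 = 1} with hW
  have hWc : IsCompact W :=
    (isCompact_univ_pi fun _ => isCompact_closedBall 0 1).inter_right
      (isClosed_eq (by fun_prop) continuous_const)
  set P : Set ((ℤ → 𝒜) × (ℤ → ℂ)) :=
    (X ×ˢ W) ∩ (fun p => quadForm (hopMatrix h p.1) S p.2) ⁻¹' Set.Iic c with hP
  have hPc : IsCompact P :=
    (hX.prod hWc).of_isClosed_subset
      (((continuousOn_quadForm_hopMatrix hXinv hcont S).mono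
        (Set.prod_mono_right (Set.subset_univ _))).preimage_isClosed_of_isClosed
        (hX.prod hWc).isClosed isClosed_Iic) Set.inter_subset_left
  refine ⟨Prod.fst '' P, ?_, hPc.image continuous_fst, ?_, ?_⟩
  · rintro _ ⟨p, hp, rfl⟩
    exact hp.1.1
  · rw [Set.eq_empty_iff_forall_notMem]
    rintro _ ⟨⟨p, hp, rfl⟩, hx⟩
    have h1 := hE p.1 hx p.2
    rw [hp.1.2.2, mul_one] at h1
    exact absurd (h1.trans hp.2) (not_le.mpr hcE)
  · intro y hy hyK w
    rcases (Finset.sum_nonneg fun k (_ : k ∈ S) => sq_nonneg ‖w k‖).eq_or_lt with h0 | hpos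
    · have hw : ∀ k ∈ S, w k = 0 := by
        intro k hk
        have := (Finset.sum_eq_zero_iff_of_nonneg fun k (_ : k ∈ S) => sq_nonneg ‖w k‖).mp
          h0.symm k hk
        simpa using this
      rw [← h0, quadForm_congr (w' := fun _ => 0) hw]
      simp [quadForm]
    · by_contra! hlt
      set s := ∑ k ∈ S, ‖w k‖ ^ 2 with hs
      set t : ℝ := (√s)⁻¹ with ht
      have hts : t ^ 2 * s = 1 := by
        rw [ht, inv_pow, Real.sq_sqrt hpos.le, inv_mul_cancel₀ hpos.ne']
      set u : ℤ → ℂ := fun k => if k ∈ S then (t : ℂ) * w k else 0 with hu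
      have huS : ∀ k ∈ S, u k = (t : ℂ) * w k := fun k hk => by simp [hu, hk]
      have hunorm : ∑ k ∈ S, ‖u k‖ ^ 2 = 1 := by
        rw [Finset.sum_congr rfl fun k hk => by rw [huS k hk], sum_norm_sq_smul, hts]
      refine hyK ⟨(y, u), ⟨⟨hy, fun k _ => ?_, hunorm⟩, ?_⟩, rfl⟩
      · rw [mem_closedBall_zero_iff]
        by_cases hk : k ∈ S
        · have h1 := Finset.single_le_sum (f := fun k => ‖u k‖ ^ 2)
            (fun k _ => sq_nonneg _) hk
          simp only [hunorm] at h1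
          exact (sq_le_one_iff₀ (norm_nonneg _)).mp h1
        · simp [hu, hk]
      · simp only [Set.mem_preimage, Set.mem_Iic]
        rw [quadForm_congr huS, quadForm_smul]
        calc t ^ 2 * quadForm (hopMatrix h y) S w ≤ t ^ 2 * (c * s) :=
              mul_le_mul_of_nonneg_left hlt.le (sq_nonneg _)
          _ = c * (t ^ 2 * s) := by ring
          _ = c := by rw [hts, mul_one]

/-- A lower bound for the form on `S` restricts to subsets. -/
theorem le_quadForm_of_subset {J : Type*} {A : J → J → ℂ} {S S' : Finset J}
    (hS : S' ⊆ S) {c : ℝ} (hA : ∀ w : J → ℂ, c * ∑ k ∈ S, ‖w k‖ ^ 2 ≤ quadForm A S w)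
    (w : J → ℂ) : c * ∑ k ∈ S', ‖w k‖ ^ 2 ≤ quadForm A S' w := by
  classical
  set u : J → ℂ := fun k => if k ∈ S' then w k else 0 with hu
  have huS : ∀ k ∈ S', w k = u k := fun k hk => by simp [hu, hk]
  have hu0 : ∀ k, k ∉ S' → u k = 0 := fun k hk => by simp [hu, hk]
  have h1 : ∑ k ∈ S', ‖w k‖ ^ 2 = ∑ k ∈ S, ‖u k‖ ^ 2 := by
    rw [Finset.sum_congr rfl fun k hk => by rw [huS k hk]]
    exact Finset.sum_subset hS fun k _ hk => by simp [hu0 k hk]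
  have h2 : quadForm A S' w = quadForm A S u := by
    rw [quadForm_congr huS]
    unfold quadForm
    congr 1
    rw [← Finset.sum_subset hS fun k _ hk => by simp [hu0 k hk]]
    exact Finset.sum_congr rfl fun k _ =>
      Finset.sum_subset hS fun l _ hl => by simp [hu0 l hl]
  rw [h1, h2]
  exact hA u

/-- Translating a test set: bounds at `tau j y` near the origin give bounds at `y` near `j`. -/
theorem le_quadForm_of_tau {y : ℤ → 𝒜} {c : ℝ} {S : Finset ℤ} (j : ℤ) {R : ℕ}
    (hS : ∀ k ∈ S, |k - j| ≤ R)
    (hy : ∀ w : ℤ → ℂ, c * ∑ k ∈ Finset.Icc (-(R : ℤ)) R, ‖w k‖ ^ 2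
      ≤ quadForm (hopMatrix h (tau j y)) (Finset.Icc (-(R : ℤ)) R) w) (w : ℤ → ℂ) :
    c * ∑ k ∈ S, ‖w k‖ ^ 2 ≤ quadForm (hopMatrix h y) S w := by
  set f : ℤ ↪ ℤ := (Equiv.addRight j).toEmbedding with hf
  have hsub : S ⊆ (Finset.Icc (-(R : ℤ)) R).map f := by
    intro k hk
    rw [Finset.mem_map]
    exact ⟨k - j, Finset.mem_Icc.mpr (abs_le.mp (hS k hk)), by simp [hf]⟩
  refine le_quadForm_of_subset hsub (fun u => ?_) w
  rw [quadForm_map, Finset.sum_map]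
  have hA : hopMatrix h (tau j y) = fun k l => hopMatrix h y (f k) (f l) :=
    funext₂ fun k l => hopMatrix_tau y j k l
  rw [← hA]
  exact hy fun k => u (f k)

/-- The lower half of the Persson-type formula. -/
theorem sInf_sInf_spectrum_eq_iSup
    [Fintype 𝒜] [TopologicalSpace 𝒜] [DiscreteTopology 𝒜]
    (hX : IsCompact X) (hXinv : ∀ (k : ℤ), ∀ x ∈ X, tau k x ∈ X)
    (hXinf_sub : Xinf ⊆ X) (hXinf_ne : Xinf.Nonempty)
    (hXinf_inv : ∀ (k : ℤ), ∀ x ∈ Xinf, tau k x ∈ Xinf)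
    {ι : Type} [Nonempty ι] [Preorder ι]
    (M : ι → Set (ℤ → 𝒜))
    (hMX : ∀ i, M i ⊆ X)
    (hMinf : ∀ i, Xinf ⊆ M i)
    (hFell : ∀ K ⊆ X, IsCompact K → K ∩ Xinf = ∅ → ∃ i₀, ∀ i ≥ i₀, M i ∩ K = ∅)
    (hcont : ∀ k : ℤ, ContinuousOn (fun x => h x k) X)
    {r : ℕ} (hsupp : ∀ (x : ℤ → 𝒜) (k : ℤ), (r : ℤ) < |k| → h x k = 0)
    (hsa : ∀ x ∈ X, ∀ k : ℤ, h (tau k x) (-k) = starRingEnd ℂ (h x k))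
    (HX : (x : ℤ → 𝒜) → x ∈ Xinf → (lp (fun _ : ℤ => ℂ) 2 →L[ℂ] lp (fun _ : ℤ => ℂ) 2))
    (hHX : ∀ (x : ℤ → 𝒜) (hx : x ∈ Xinf) (v : lp (fun _ : ℤ => ℂ) 2) (k : ℤ),
      (HX x hx v) k = ∑' l : ℤ, h (tau l x) (k - l) * v l)
    (HM : (i : ι) → (y : ℤ → 𝒜) → y ∈ M i →
      (lp (fun _ : {k : ℤ // tau k y ∈ M i} => ℂ) 2 →L[ℂ]
        lp (fun _ : {k : ℤ // tau k y ∈ M i} => ℂ) 2))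
    (hHM : ∀ (i : ι) (y : ℤ → 𝒜) (hy : y ∈ M i)
        (v : lp (fun _ : {k : ℤ // tau k y ∈ M i} => ℂ) 2) (k : {k : ℤ // tau k y ∈ M i}),
      (HM i y hy v) k = ∑' l : {k : ℤ // tau k y ∈ M i}, h (tau ↑l y) (↑k - ↑l) * v l) :
    sInf {t : ℝ | ∃ (x : ℤ → 𝒜) (hx : x ∈ Xinf), t = sInf (spectrum ℝ (HX x hx))}
        = ⨆ i, sInf {s : ℝ | ∃ (y : ℤ → 𝒜) (hy : y ∈ M i),
            s = sInf (spectrum ℝ (HM i y hy))} := by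
  obtain ⟨C, hC, hCb⟩ := exists_norm_le hX hcont hsupp
  have hband : ∀ y k l, (r : ℤ) < |k - l| → hopMatrix h y k l = 0 :=
    fun y k l hkl => hsupp _ _ hkl
  have hbd : ∀ y ∈ X, ∀ k l, ‖hopMatrix h y k l‖ ≤ C :=
    fun y hy k l => hCb _ (hXinv l y hy) _
  have hstar : ∀ y ∈ X, ∀ k l, star (hopMatrix h y k l) = hopMatrix h y l k :=
    fun y hy => star_hopMatrix hXinv hsa hy
  have hspecX : ∀ x (hx : x ∈ Xinf) (c : ℝ), c ≤ sInf (spectrum ℝ (HX x hx)) ↔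
      ∀ (S : Finset ℤ) (w : ℤ → ℂ),
        c * ∑ k ∈ S, ‖w k‖ ^ 2 ≤ quadForm (hopMatrix h x) S w := fun x hx c =>
    le_sInf_spectrum_iff_of_matrix (hstar x (hXinf_sub hx)) (hHX x hx) c
  have hspecM : ∀ i y (hy : y ∈ M i) (c : ℝ), c ≤ sInf (spectrum ℝ (HM i y hy)) ↔
      ∀ S : Finset ℤ, (∀ k ∈ S, tau k y ∈ M i) → ∀ w : ℤ → ℂ,
        c * ∑ k ∈ S, ‖w k‖ ^ 2 ≤ quadForm (hopMatrix h y) S w := fun i y hy c =>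
    have : Nonempty {k : ℤ // tau k y ∈ M i} := ⟨⟨0, by rwa [tau_zero]⟩⟩
    le_sInf_spectrum_iff_of_matrix_subtype (A := hopMatrix h y) (hstar y (hMX i hy))
      (hHM i y hy) c
  have hlow : ∀ y ∈ X, ∀ (S : Finset ℤ) (w : ℤ → ℂ),
      -(C * (2 * r + 1)) * ∑ k ∈ S, ‖w k‖ ^ 2 ≤ quadForm (hopMatrix h y) S w := by
    intro y hy S w
    have := (abs_le.mp (abs_quadForm_le hC (hbd y hy) (hband y) S w)).1
    linarith
  set a := sInf {t : ℝ | ∃ (x : ℤ → 𝒜) (hx : x ∈ Xinf), t = sInf (spectrum ℝ (HX x hx))} with ha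
  set b : ι → ℝ := fun i => sInf {s : ℝ | ∃ (y : ℤ → 𝒜) (hy : y ∈ M i),
    s = sInf (spectrum ℝ (HM i y hy))} with hb
  have haX : ∀ x (hx : x ∈ Xinf), a ≤ sInf (spectrum ℝ (HX x hx)) := by
    intro x hx
    refine csInf_le ⟨-(C * (2 * r + 1)), ?_⟩ ⟨x, hx, rfl⟩
    rintro _ ⟨y, hy, rfl⟩
    exact (hspecX y hy _).mpr (hlow y (hXinf_sub hy))
  have hbM : ∀ i y (hy : y ∈ M i), b i ≤ sInf (spectrum ℝ (HM i y hy)) := by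
    intro i x hx
    refine csInf_le ⟨-(C * (2 * r + 1)), ?_⟩ ⟨x, hx, rfl⟩
    rintro _ ⟨y, hy, rfl⟩
    exact (hspecM i y hy _).mpr fun S _ => hlow y (hMX i hy) S
  have hba : ∀ i, b i ≤ a := by
    intro i
    obtain ⟨x₀, hx₀⟩ := hXinf_ne
    refine le_csInf ⟨_, x₀, hx₀, rfl⟩ ?_
    rintro _ ⟨x, hx, rfl⟩
    refine (hspecX x hx _).mpr fun S w => ?_
    exact (hspecM i x (hMinf i hx) _).mp (hbM i x (hMinf i hx)) S
      (fun k _ => hMinf i (hXinf_inv k x hx)) w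
  refine le_antisymm (le_of_forall_lt_imp_le_of_dense fun c hc => ?_) (ciSup_le hba)
  obtain ⟨c', hcc', hc'a⟩ := exists_between hc
  obtain ⟨R, hR⟩ := exists_nat_gt (max 0 (r * C * (2 * r + 1) / (c' - c)))
  have hR0 : (0 : ℝ) < R := (le_max_left _ _).trans_lt hR
  have herr : c ≤ c' - r * C * (2 * r + 1) / R := by
    have h1 := (le_max_right _ _).trans_lt hR
    rw [div_lt_iff₀ (sub_pos.mpr hcc')] at h1
    have h2 : r * C * (2 * r + 1) / R ≤ c' - c := by
      rw [div_le_iff₀ hR0]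
      linarith
    linarith
  obtain ⟨K, hKX, hKc, hKinf, hK⟩ := exists_isCompact_lt_quadForm hX hXinv hcont hc'a
    (Finset.Icc (-(R : ℤ)) R) fun x hx => (hspecX x hx a).mp (haX x hx) _
  obtain ⟨i, hi⟩ := hFell K hKX hKc hKinf
  have hiK : ∀ y ∈ M i, y ∉ K := fun y hy hyK =>
    Set.notMem_empty y (hi i le_rfl ▸ ⟨hy, hyK⟩)
  refine le_trans ?_ (le_ciSup ⟨a, Set.forall_mem_range.mpr hba⟩ i)
  obtain ⟨x₀, hx₀⟩ := hXinf_ne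
  refine le_csInf ⟨_, x₀, hMinf i hx₀, rfl⟩ ?_
  rintro _ ⟨y, hy, rfl⟩
  refine (hspecM i y hy c).mpr fun S hS w => ?_
  refine le_trans (mul_le_mul_of_nonneg_right herr (Finset.sum_nonneg fun _ _ => sq_nonneg _)) ?_
  refine le_quadForm_of_window hC (hbd y (hMX i hy)) (hband y) S w (Nat.cast_pos.mp hR0)
    fun m => ?_
  rcases (window S R m).eq_empty_or_nonempty with h0 | ⟨j, hj⟩
  · simp [h0, quadForm]
  · have hjM : tau j y ∈ M i := hS j (Finset.mem_filter.mp hj).1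
    refine le_quadForm_of_tau j (R := R) (fun k hk => ?_)
      (hK _ (hMX i hjM) (hiK _ hjM)) w
    simp only [window, Finset.mem_filter] at hj hk
    rw [abs_le]
    omega

end Subshift

theorem Real.sSup_sSup_eq_neg_sInf_sInf_neg {α : Type*} {p : α → Prop} (F G : (x : α) → p x → Set ℝ)
    (hFG : ∀ x hx, G x hx = -F x hx) :
    sSup {t : ℝ | ∃ (x : α) (hx : p x), t = sSup (F x hx)}
      = -sInf {t : ℝ | ∃ (x : α) (hx : p x), t = sInf (G x hx)} := by
  rw [← Real.sSup_neg]
  congr 1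
  ext t
  simp only [Set.mem_ofPred_eq, Set.mem_neg, hFG, Real.sInf_def, neg_neg, neg_inj]

/-- **Persson-type formula for bi-sided subshifts** (Theorem 7.4 of the paper).
`X ⊆ 𝒜^ℤ` is a bi-sided subshift, `X∞ ⊆ X` a nonempty closed shift-invariant subset, and
`(M i)` a net of clopen subsets of `X` containing `X∞` and Fell-converging to `X∞`
(equivalently: eventually disjoint from every compact `K ⊆ X` disjoint from `X∞`).
`h : X × ℤ → ℂ` is continuous, compactly supported and self-adjoint.  `HX x hx` is the
operator `H_x^{X∞}` on `ℓ²(ℤ)` (recall `ℤ_x(X∞) = ℤ` by invariance) and `HM i y hy` is the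
operator `H_y^{M i}` on `ℓ²(ℤ_y(M i))`, both characterized by their matrix formulas.  Then
`inf_{x ∈ X∞} inf sp(H_x^{X∞}) = sup_i inf_{y ∈ M i} inf sp(H_y^{M i})` and
`sup_{x ∈ X∞} sup sp(H_x^{X∞}) = inf_i sup_{y ∈ M i} sup sp(H_y^{M i})`. -/
theorem persson_bisided_subshift
    {𝒜 : Type} [Fintype 𝒜] [TopologicalSpace 𝒜] [DiscreteTopology 𝒜]
    (X : Set (ℤ → 𝒜)) (hXcl : IsClosed X) (hXinv : ∀ (k : ℤ), ∀ x ∈ X, tau k x ∈ X)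
    (Xinf : Set (ℤ → 𝒜)) (hXinf_sub : Xinf ⊆ X) (hXinf_ne : Xinf.Nonempty)
    (hXinf_cl : IsClosed Xinf) (hXinf_inv : ∀ (k : ℤ), ∀ x ∈ Xinf, tau k x ∈ Xinf)
    -- the net of clopen subsets of X
    {ι : Type} [Nonempty ι] [Preorder ι] [IsDirected ι (· ≤ ·)]
    (M : ι → Set (ℤ → 𝒜))
    (hMX : ∀ i, M i ⊆ X)
    (hMclopen : ∀ i, IsClopen {p : X | ↑p ∈ M i})
    (hMinf : ∀ i, Xinf ⊆ M i)
    -- Fell convergence M i → X∞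
    (hFell : ∀ K ⊆ X, IsCompact K → K ∩ Xinf = ∅ → ∃ i₀, ∀ i ≥ i₀, M i ∩ K = ∅)
    -- h : X × ℤ → ℂ continuous with compact support and self-adjoint
    (h : (ℤ → 𝒜) → ℤ → ℂ)
    (hcont : ∀ k : ℤ, ContinuousOn (fun x => h x k) X)
    (hsupp : ∃ r > (0 : ℝ), ∀ (x : ℤ → 𝒜) (k : ℤ), (|k| : ℝ) > r → h x k = 0)
    (hsa : ∀ x ∈ X, ∀ k : ℤ, h (tau k x) (-k) = starRingEnd ℂ (h x k))
    -- the operators H_x^{X∞} on ℓ²(ℤ)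
    (HX : (x : ℤ → 𝒜) → x ∈ Xinf → (lp (fun _ : ℤ => ℂ) 2 →L[ℂ] lp (fun _ : ℤ => ℂ) 2))
    (hHX : ∀ (x : ℤ → 𝒜) (hx : x ∈ Xinf) (v : lp (fun _ : ℤ => ℂ) 2) (k : ℤ),
      (HX x hx v) k = ∑' l : ℤ, h (tau l x) (k - l) * v l)
    -- the operators H_y^{M i} on ℓ²(ℤ_y(M i))
    (HM : (i : ι) → (y : ℤ → 𝒜) → y ∈ M i →
      (lp (fun _ : {k : ℤ // tau k y ∈ M i} => ℂ) 2 →L[ℂ]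
        lp (fun _ : {k : ℤ // tau k y ∈ M i} => ℂ) 2))
    (hHM : ∀ (i : ι) (y : ℤ → 𝒜) (hy : y ∈ M i)
        (v : lp (fun _ : {k : ℤ // tau k y ∈ M i} => ℂ) 2) (k : {k : ℤ // tau k y ∈ M i}),
      (HM i y hy v) k = ∑' l : {k : ℤ // tau k y ∈ M i}, h (tau ↑l y) (↑k - ↑l) * v l) :
    (sInf {t : ℝ | ∃ (x : ℤ → 𝒜) (hx : x ∈ Xinf), t = sInf (spectrum ℝ (HX x hx))}
        = ⨆ i, sInf {s : ℝ | ∃ (y : ℤ → 𝒜) (hy : y ∈ M i),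
            s = sInf (spectrum ℝ (HM i y hy))}) ∧
    (sSup {t : ℝ | ∃ (x : ℤ → 𝒜) (hx : x ∈ Xinf), t = sSup (spectrum ℝ (HX x hx))}
        = ⨅ i, sSup {s : ℝ | ∃ (y : ℤ → 𝒜) (hy : y ∈ M i),
            s = sSup (spectrum ℝ (HM i y hy))}) := by
  have hX : IsCompact X := hXcl.isCompact
  obtain ⟨r, -, hr⟩ := hsupp
  have hsupp' : ∀ (x : ℤ → 𝒜) (k : ℤ), ((⌈r⌉₊ : ℕ) : ℤ) < |k| → h x k = 0 := by
    intro x k hk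
    refine hr x k (lt_of_le_of_lt (Nat.le_ceil r) ?_)
    exact_mod_cast hk
  refine ⟨sInf_sInf_spectrum_eq_iSup hX hXinv hXinf_sub hXinf_ne hXinf_inv M hMX hMinf hFell
    hcont hsupp' hsa HX hHX HM hHM, ?_⟩
  have hneg := sInf_sInf_spectrum_eq_iSup (h := fun x k => -h x k) hX hXinv hXinf_sub hXinf_ne
    hXinf_inv M hMX hMinf hFell (fun k => (hcont k).neg)
    (fun x k hk => by rw [hsupp' x k hk, neg_zero])
    (fun x hx k => by rw [hsa x hx k, map_neg])
    (fun x hx => -HX x hx)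
    (fun x hx v k => by
      rw [neg_apply, lp.coeFn_neg, Pi.neg_apply, hHX, ← tsum_neg]
      simp only [neg_mul])
    (fun i y hy => -HM i y hy)
    (fun i y hy v k => by
      rw [neg_apply, lp.coeFn_neg, Pi.neg_apply, hHM, ← tsum_neg]
      simp only [neg_mul])
  rw [Real.sSup_sSup_eq_neg_sInf_sInf_neg _ (fun x hx => spectrum ℝ (-HX x hx))
    fun x hx => (spectrum.neg_eq _).symm, hneg, iSup, ← Real.sInf_neg, iInf]
  congr 1
  ext t
  simp only [Set.mem_neg, Set.mem_range]
  refine exists_congr fun i => ?_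
  rw [Real.sSup_sSup_eq_neg_sInf_sInf_neg _ (fun y hy => spectrum ℝ (-HM i y hy))
    fun y hy => (spectrum.neg_eq _).symm, neg_eq_iff_eq_neg]

end
end
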